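/- Fix n ≥ 2, λ > 0 and δ ∈ (0,1). There exists a constant C > 0, depending only on n, λ and δ, with the following property. In the setting of a Cordes coefficient family, define for a smooth ℤⁿ-periodic pair (w, u'), with w : ℝⁿ → ℝⁿ and u' : ℝⁿ → ℝ, the mixed operator F_γ^M[(w,u')](y) := inf_{α∈𝒜} sup_{β∈ℬ} [ γ(y,α,β)·( −A(y,α,β):Dw(y) − b(y,α,β)·∇u'(y) + c(y,α,β)·u'(y) − f(y,α,β) ) ], where Dw is the Jacobian of w, and define rot(w) := Dw − (Dw)ᵀ. Then, for every smooth ℤⁿ-periodic function u : ℝⁿ → ℝ with F_γ[u] = 0 on ℝⁿ and every smooth ℤⁿ-periodic pair (w, u') with ∫_Y w = 0, one has ∫_Y |D(∇u − w)|² + 2λ ∫_Y |∇(u − u')|² + λ² ∫_Y (u − u')² ≤ C·( ∫_Y (F_γ^M[(w,u')])² + ∫_Y |rot(w)|² + ∫_Y |∇u' − w|² ), where |·| on matrices denotes the Frobenius norm. -/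

import Mathlib

open MeasureTheory Matrix BigOperators

/-- Frobenius inner product `A : M = tr(Aᵀ M)` of two real `n × n` matrices. -/
noncomputable def fip {n : ℕ} (A M : Matrix (Fin n) (Fin n) ℝ) : ℝ := (Aᵀ * M).trace

/-- Renormalization function `γ = (tr A + c/λ) / (|A|² + |b|²/(2λ) + c²/λ²)`. -/
noncomputable def gam {n : ℕ} (lam : ℝ) (A : Matrix (Fin n) (Fin n) ℝ)
    (b : Fin n → ℝ) (c : ℝ) : ℝ :=
  (A.trace + c / lam) / (fip A A + (∑ i, b i ^ 2) / (2 * lam) + c ^ 2 / lam ^ 2)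

/-- Partial derivative `∂v/∂xᵢ` of a function on `ℝⁿ = Fin n → ℝ`. -/
noncomputable def pd {n : ℕ} (i : Fin n) (v : (Fin n → ℝ) → ℝ) (x : Fin n → ℝ) : ℝ :=
  fderiv ℝ v x (Pi.single i 1)

/-- Hessian matrix of a function on `ℝⁿ`. -/
noncomputable def hess {n : ℕ} (v : (Fin n → ℝ) → ℝ) (x : Fin n → ℝ) :
    Matrix (Fin n) (Fin n) ℝ :=
  Matrix.of fun i j => pd i (pd j v) x

/-- The operator `L_λ v = λ v − Δ v`. -/
noncomputable def Llam {n : ℕ} (lam : ℝ) (v : (Fin n → ℝ) → ℝ) (x : Fin n → ℝ) : ℝ :=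
  lam * v x - ∑ i, pd i (pd i v) x

/-- `ℤⁿ`-periodicity of a function on `ℝⁿ`. -/
def ZPeriodic {n : ℕ} (v : (Fin n → ℝ) → ℝ) : Prop :=
  ∀ (x : Fin n → ℝ) (z : Fin n → ℤ), v (x + fun i => (z i : ℝ)) = v x

/-- The renormalized HJBI operator
`F_γ[v](y) = inf_α sup_β γ·(−A:∇²v − b·∇v + c v − f)` evaluated at `(y,α,β)`. -/
noncomputable def Fgam {n : ℕ} {𝒜 ℬ : Type} (lam : ℝ)
    (A : (Fin n → ℝ) × 𝒜 × ℬ → Matrix (Fin n) (Fin n) ℝ)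
    (b : (Fin n → ℝ) × 𝒜 × ℬ → Fin n → ℝ)
    (c f : (Fin n → ℝ) × 𝒜 × ℬ → ℝ)
    (v : (Fin n → ℝ) → ℝ) (y : Fin n → ℝ) : ℝ :=
  ⨅ α : 𝒜, ⨆ β : ℬ,
    gam lam (A (y, α, β)) (b (y, α, β)) (c (y, α, β)) *
      (-(fip (A (y, α, β)) (hess v y)) - (∑ i, b (y, α, β) i * pd i v y)
        + c (y, α, β) * v y - f (y, α, β))

/-- `ℤⁿ`-periodicity of a vector field on `ℝⁿ`. -/
def ZPeriodicV {n : ℕ} (w : (Fin n → ℝ) → Fin n → ℝ) : Prop :=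
  ∀ (x : Fin n → ℝ) (z : Fin n → ℤ), w (x + fun i => (z i : ℝ)) = w x

/-- Jacobian matrix `(Dw)_{ij} = ∂wᵢ/∂yⱼ` of a vector field on `ℝⁿ`. -/
noncomputable def jac {n : ℕ} (w : (Fin n → ℝ) → Fin n → ℝ) (x : Fin n → ℝ) :
    Matrix (Fin n) (Fin n) ℝ :=
  Matrix.of fun i j => pd j (fun y => w y i) x

/-- The mixed renormalized HJBI operator
`F_γ^M[(w,u')](y) = inf_α sup_β γ·(−A:Dw − b·∇u' + c u' − f)`. -/
noncomputable def FgamM {n : ℕ} {𝒜 ℬ : Type} (lam : ℝ)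
    (A : (Fin n → ℝ) × 𝒜 × ℬ → Matrix (Fin n) (Fin n) ℝ)
    (b : (Fin n → ℝ) × 𝒜 × ℬ → Fin n → ℝ)
    (c f : (Fin n → ℝ) × 𝒜 × ℬ → ℝ)
    (w : (Fin n → ℝ) → Fin n → ℝ) (u' : (Fin n → ℝ) → ℝ) (y : Fin n → ℝ) : ℝ :=
  ⨅ α : 𝒜, ⨆ β : ℬ,
    gam lam (A (y, α, β)) (b (y, α, β)) (c (y, α, β)) *
      (-(fip (A (y, α, β)) (jac w y)) - (∑ i, b (y, α, β) i * pd i u' y)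
        + c (y, α, β) * u' y - f (y, α, β))


theorem fip_eq {n : ℕ} (A M : Matrix (Fin n) (Fin n) ℝ) :
    fip A M = ∑ i, ∑ j, A i j * M i j := by
  unfold fip
  rw [Matrix.trace, Finset.sum_comm]
  simp [Matrix.mul_apply]

theorem cs_add {X Y a b c d : ℝ} (ha : 0 ≤ a) (hb : 0 ≤ b) (hc : 0 ≤ c) (hd : 0 ≤ d)
    (hX : X ^ 2 ≤ a * b) (hY : Y ^ 2 ≤ c * d) : (X + Y) ^ 2 ≤ (a + c) * (b + d) := by
  have h1 : (2 * X * Y) ^ 2 ≤ (a * d + c * b) ^ 2 := by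
    have : X ^ 2 * Y ^ 2 ≤ (a * b) * (c * d) := by gcongr
    nlinarith [sq_nonneg (a * d - c * b)]
  have h2 := abs_le_of_sq_le_sq' h1 (by positivity)
  nlinarith [h2.2]

theorem fip_cs {n : ℕ} (A M : Matrix (Fin n) (Fin n) ℝ) :
    (fip A M) ^ 2 ≤ fip A A * fip M M := by
  simp only [fip_eq, ← Finset.sum_product', ← pow_two]
  exact Finset.sum_mul_sq_le_sq_mul_sq _ _ _

theorem fip_self_nonneg {n : ℕ} (A : Matrix (Fin n) (Fin n) ℝ) : 0 ≤ fip A A := by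
  rw [fip_eq]
  exact Finset.sum_nonneg fun i _ => Finset.sum_nonneg fun j _ => mul_self_nonneg _

theorem fip_add_right {n : ℕ} (A M N : Matrix (Fin n) (Fin n) ℝ) :
    fip A (M + N) = fip A M + fip A N := by
  simp [fip, Matrix.mul_add]

theorem fip_sub_right {n : ℕ} (A M N : Matrix (Fin n) (Fin n) ℝ) :
    fip A (M - N) = fip A M - fip A N := by
  simp [fip, Matrix.mul_sub]

theorem fip_sub_left {n : ℕ} (A M N : Matrix (Fin n) (Fin n) ℝ) :
    fip (M - N) A = fip M A - fip N A := by
  simp [fip, Matrix.sub_mul]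

theorem fip_smul_left {n : ℕ} (t : ℝ) (A M : Matrix (Fin n) (Fin n) ℝ) :
    fip (t • A) M = t * fip A M := by
  simp [fip]

theorem fip_comm {n : ℕ} (A M : Matrix (Fin n) (Fin n) ℝ) : fip A M = fip M A := by
  simp only [fip_eq, mul_comm]

theorem fip_one_left {n : ℕ} (M : Matrix (Fin n) (Fin n) ℝ) : fip 1 M = M.trace := by
  simp [fip]

/-- The Cordes inequality. -/
theorem cordes {n : ℕ} (lam δ : ℝ) (hlam : 0 < lam) (hδ : 0 < δ)
    (A : Matrix (Fin n) (Fin n) ℝ) (b : Fin n → ℝ) (c : ℝ) (hc : 0 < c)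
    (h : fip A A + (∑ i, b i ^ 2) / (2 * lam) + c ^ 2 / lam ^ 2
          ≤ (1 / ((n : ℝ) + δ)) * (A.trace + c / lam) ^ 2)
    (M : Matrix (Fin n) (Fin n) ℝ) (p : Fin n → ℝ) (r : ℝ) :
    (gam lam A b c * (-(fip A M) - (∑ i, b i * p i) + c * r) - (lam * r - M.trace)) ^ 2
      ≤ (1 - δ) * (fip M M + 2 * lam * (∑ i, p i ^ 2) + lam ^ 2 * r ^ 2) := by
  set N := fip A A + (∑ i, b i ^ 2) / (2 * lam) + c ^ 2 / lam ^ 2 with hN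
  have hb0 : 0 ≤ ∑ i, b i ^ 2 := Finset.sum_nonneg fun i _ => sq_nonneg _
  have hp0 : 0 ≤ ∑ i, p i ^ 2 := Finset.sum_nonneg fun i _ => sq_nonneg _
  have hNpos : 0 < N := by
    have := fip_self_nonneg A
    positivity
  have hg : gam lam A b c = (A.trace + c / lam) / N := rfl
  set g := gam lam A b c with hgdef
  set s := A.trace + c / lam with hs
  have hgN : g * N = s := by rw [hg]; field_simp
  have hgs : (n : ℝ) + δ ≤ g * s := by
    rw [hg, div_mul_eq_mul_div, le_div_iff₀ hNpos]
    have hn : (0 : ℝ) < n + δ := by positivity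
    rw [one_div, inv_mul_eq_div, le_div_iff₀ hn] at h
    nlinarith
  have e1 := fip_cs (1 - g • A) M
  have e2 : (-(g * ∑ i, b i * p i)) ^ 2
      ≤ (g ^ 2 * (∑ i, b i ^ 2) / (2 * lam)) * (2 * lam * ∑ i, p i ^ 2) := by
    have := Finset.sum_mul_sq_le_sq_mul_sq Finset.univ b p
    calc _ = g ^ 2 * (∑ i, b i * p i) ^ 2 := by ring
      _ ≤ g ^ 2 * ((∑ i, b i ^ 2) * ∑ i, p i ^ 2) := by gcongr
      _ = _ := by field_simp
  have e3 : ((g * c - lam) * r) ^ 2 ≤ (1 - g * c / lam) ^ 2 * (lam ^ 2 * r ^ 2) := by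
    apply le_of_eq
    field_simp
    ring
  have e12 := cs_add (fip_self_nonneg _) (fip_self_nonneg _) (by positivity) (by positivity) e1 e2
  have e123 := cs_add (add_nonneg (fip_self_nonneg _) (by positivity))
    (add_nonneg (fip_self_nonneg _) (by positivity)) (by positivity) (by positivity) e12 e3
  have hk : fip (1 - g • A) (1 - g • A) + g ^ 2 * (∑ i, b i ^ 2) / (2 * lam)
      + (1 - g * c / lam) ^ 2 = n + 1 - g * s := by
    have : fip (1 - g • A) (1 - g • A) = n - 2 * g * A.trace + g ^ 2 * fip A A := by
      rw [fip_sub_left, fip_sub_right, fip_smul_left, fip_sub_right, fip_comm 1 (g • A),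
        fip_comm A (g • A), fip_smul_left, fip_smul_left, fip_comm A 1, fip_one_left,
        fip_one_left]
      simp
      ring
    rw [this]
    have h2 : g * s = g ^ 2 * N := by rw [← hgN]; ring
    have h3 : n + 1 - g * s = n + 1 - 2 * (g * s) + g ^ 2 * N := by linarith
    rw [h3, hN, hs]
    ring
  rw [hk] at e123
  have hr : g * (-(fip A M) - (∑ i, b i * p i) + c * r) - (lam * r - M.trace)
      = fip (1 - g • A) M + -(g * ∑ i, b i * p i) + (g * c - lam) * r := by
    rw [fip_sub_left, fip_smul_left, fip_one_left]; ring
  rw [hr]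
  refine e123.trans ?_
  have := fip_self_nonneg M
  exact mul_le_mul_of_nonneg_right (by linarith) (by positivity)

theorem alg {n : ℕ} (lam δ : ℝ) (hlam : 0 < lam) (hδ : 0 < δ)
    (F z : ℝ) (p w r : Fin n → ℝ) (G : Matrix (Fin n) (Fin n) ℝ) (hw : ∀ i, w i = p i + r i)
    (h : (F + (lam * z - G.trace)) ^ 2
      ≤ (1 - δ) * (fip G G + 2 * lam * (∑ i, p i ^ 2) + lam ^ 2 * z ^ 2)) :
    fip G G + 2 * lam * (∑ i, p i ^ 2) + lam ^ 2 * z ^ 2 ≤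
      (8 / (3 * δ) * (2 + 2 / δ + 4 * lam / δ)) *
        (F ^ 2 + fip (G - Gᵀ) (G - Gᵀ) + ∑ i, r i ^ 2)
      - 8 / (3 * δ) * (- 2 * lam * (∑ i, (z * G i i + p i * w i))
        + ∑ i, ∑ j, (G i i * G j j - G i j * G j i)) := by
  set e := fip G G + 2 * lam * (∑ i, p i ^ 2) + lam ^ 2 * z ^ 2 with he
  have hp0 : 0 ≤ ∑ i, p i ^ 2 := Finset.sum_nonneg fun i _ => sq_nonneg _
  have hr0 : 0 ≤ ∑ i, r i ^ 2 := Finset.sum_nonneg fun i _ => sq_nonneg _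
  have hG0 := fip_self_nonneg G
  have hR0 := fip_self_nonneg (G - Gᵀ)
  have he0 : 0 ≤ e := by positivity
  set S := lam * z - G.trace with hS
  have t1 : ∑ i, (z * G i i + p i * w i) = z * G.trace + (∑ i, p i ^ 2) + ∑ i, p i * r i := by
    simp only [hw, Matrix.trace, Matrix.diag, Finset.mul_sum, ← Finset.sum_add_distrib]
    exact Finset.sum_congr rfl fun i _ => by ring
  have t2 : ∑ i, ∑ j, (G i i * G j j - G i j * G j i)
      = G.trace ^ 2 - fip G G + fip (G - Gᵀ) (G - Gᵀ) / 2 := by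
    have a1 : ∑ i, ∑ j, G j i * G j i = ∑ i, ∑ j, G i j * G i j := Finset.sum_comm
    have a2 : fip (G - Gᵀ) (G - Gᵀ) = 2 * fip G G - 2 * ∑ i, ∑ j, G i j * G j i := by
      have : fip (G - Gᵀ) (G - Gᵀ) = ∑ i, ∑ j, G i j * G i j + ∑ i, ∑ j, G j i * G j i
          - 2 * ∑ i, ∑ j, G i j * G j i := by
        rw [fip_eq]
        simp only [Finset.mul_sum, ← Finset.sum_add_distrib, ← Finset.sum_sub_distrib,
          Matrix.sub_apply, Matrix.transpose_apply]
        exact Finset.sum_congr rfl fun i _ => Finset.sum_congr rfl fun j _ => by ring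
      rw [this, a1, fip_eq]; ring
    rw [a2, pow_two, Matrix.trace, Finset.sum_mul_sum]
    simp only [Finset.sum_sub_distrib, Matrix.diag]
    ring
  rw [t1, t2]
  set R := fip (G - Gᵀ) (G - Gᵀ)
  have t3 : -(2 * lam * ∑ i, p i * r i) ≤ δ / 8 * e + 4 * lam / δ * ∑ i, r i ^ 2 := by
    have : -(2 * lam * ∑ i, p i * r i)
        ≤ 2 * lam * (δ / 8 * (∑ i, p i ^ 2) + 2 / δ * ∑ i, r i ^ 2) := by
      rw [← mul_neg]
      gcongr
      rw [← Finset.sum_neg_distrib, Finset.mul_sum, Finset.mul_sum, ← Finset.sum_add_distrib]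
      refine Finset.sum_le_sum fun i _ => ?_
      have : δ / 8 * p i ^ 2 + 2 / δ * r i ^ 2 - -(p i * r i)
        = (δ * p i + 4 * r i) ^ 2 / (8 * δ) := by field_simp; ring
      have h2 : 0 ≤ (δ * p i + 4 * r i) ^ 2 / (8 * δ) := by positivity
      linarith
    have h2 : 2 * lam * (δ / 8 * (∑ i, p i ^ 2)) ≤ δ / 8 * e := by
      rw [he]
      have : 0 ≤ δ / 8 * (fip G G + lam ^ 2 * z ^ 2) := by positivity
      linarith
    have h3 : 2 * lam * (2 / δ * ∑ i, r i ^ 2) = 4 * lam / δ * ∑ i, r i ^ 2 := by ring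
    linarith
  have t4 : S ^ 2 ≤ (1 + 2 / δ) * F ^ 2 + (1 - δ / 2) * e := by
    have h1 : S ^ 2 ≤ (1 + 2 / δ) * F ^ 2 + (1 + δ / 2) * (F + S) ^ 2 := by
      have : (1 + 2 / δ) * F ^ 2 + (1 + δ / 2) * (F + S) ^ 2 - S ^ 2
        = (2 * F + δ * (F + S)) ^ 2 / (2 * δ) + 0 := by field_simp; ring
      have h2 : 0 ≤ (2 * F + δ * (F + S)) ^ 2 / (2 * δ) := by positivity
      linarith
    have h2 : (1 + δ / 2) * (F + S) ^ 2 ≤ (1 + δ / 2) * ((1 - δ) * e) := by gcongr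
    nlinarith [mul_nonneg (mul_nonneg hδ.le hδ.le) he0]
  have key : 3 * δ / 8 * e ≤ (1 + 2 / δ) * F ^ 2 + R / 2 + 4 * lam / δ * ∑ i, r i ^ 2
      - (-2 * lam * (z * G.trace + (∑ i, p i ^ 2) + ∑ i, p i * r i)
        + (G.trace ^ 2 - fip G G + R / 2)) := by
    have hS2 : S ^ 2 = lam ^ 2 * z ^ 2 - 2 * lam * z * G.trace + G.trace ^ 2 := by rw [hS]; ring
    linarith
  have k2 : (1 + 2 / δ) * F ^ 2 + R / 2 + 4 * lam / δ * ∑ i, r i ^ 2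
      ≤ (2 + 2 / δ + 4 * lam / δ) * (F ^ 2 + R + ∑ i, r i ^ 2) := by
    have c1 : 0 ≤ 2 / δ := by positivity
    have c2 : 0 ≤ 4 * lam / δ := by positivity
    nlinarith [mul_nonneg c1 hR0, mul_nonneg c1 hr0, mul_nonneg c2 hR0, sq_nonneg F,
      mul_nonneg c2 (sq_nonneg F)]
  have : e = 8 / (3 * δ) * (3 * δ / 8 * e) := by field_simp
  rw [this, mul_assoc, ← mul_sub]
  gcongr
  linarith

theorem infsup_le {𝒜 ℬ : Type} [TopologicalSpace 𝒜] [CompactSpace 𝒜] [Nonempty 𝒜]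
    [TopologicalSpace ℬ] [CompactSpace ℬ] [Nonempty ℬ] (G H : 𝒜 → ℬ → ℝ)
    (hG : Continuous (fun q : 𝒜 × ℬ => G q.1 q.2)) (hH : Continuous (fun q : 𝒜 × ℬ => H q.1 q.2))
    (k : ℝ) (h : ∀ α β, G α β ≤ H α β + k) :
    (⨅ α, ⨆ β, G α β) ≤ (⨅ α, ⨆ β, H α β) + k := by
  obtain ⟨m, hm⟩ := (isCompact_range hG).bddBelow
  obtain ⟨M, hM⟩ := (isCompact_range hH).bddAbove
  obtain ⟨Mg, hMg⟩ := (isCompact_range hG).bddAbove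
  have bG : ∀ α, BddAbove (Set.range (G α)) := fun α =>
    ⟨Mg, by rintro _ ⟨β, rfl⟩; exact hMg ⟨(α, β), rfl⟩⟩
  have bH : ∀ α, BddAbove (Set.range (H α)) := fun α =>
    ⟨M, by rintro _ ⟨β, rfl⟩; exact hM ⟨(α, β), rfl⟩⟩
  rw [← sub_le_iff_le_add]
  refine le_ciInf fun α => ?_
  rw [sub_le_iff_le_add]
  refine (ciInf_le ⟨m, ?_⟩ α).trans ?_
  · rintro _ ⟨a, rfl⟩
    obtain ⟨β⟩ := ‹Nonempty ℬ›
    exact (hm ⟨(a, β), rfl⟩).trans (le_ciSup (bG a) β)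
  · exact ciSup_le fun β => (h α β).trans (by gcongr; exact le_ciSup (bH α) β)

theorem infsup_cont {X 𝒜 ℬ : Type} [TopologicalSpace X] [TopologicalSpace 𝒜] [CompactSpace 𝒜]
    [TopologicalSpace ℬ] [CompactSpace ℬ] (G : X → 𝒜 → ℬ → ℝ)
    (hG : Continuous (fun q : X × 𝒜 × ℬ => G q.1 q.2.1 q.2.2)) :
    Continuous fun x => ⨅ α, ⨆ β, G x α β := by
  have h1 : Continuous fun q : X × 𝒜 => ⨆ β, G q.1 q.2 β := by
    have := IsCompact.continuous_sSup (f := fun (q : X × 𝒜) (β : ℬ) => G q.1 q.2 β)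
      (isCompact_univ (X := ℬ))
      (by
        change Continuous fun q : (X × 𝒜) × ℬ => G q.1.1 q.1.2 q.2
        exact hG.comp (f := fun q : (X × 𝒜) × ℬ => (q.1.1, q.1.2, q.2)) (by fun_prop))
    simpa [Set.image_univ, sSup_range] using this
  have := IsCompact.continuous_sInf (f := fun (x : X) (α : 𝒜) => ⨆ β, G x α β)
      (isCompact_univ (X := 𝒜)) h1
  simpa [Set.image_univ, sInf_range] using this

theorem pd_smooth {n : ℕ} {v : (Fin n → ℝ) → ℝ} (hv : ContDiff ℝ (⊤ : ℕ∞) v) (i : Fin n) :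
    ContDiff ℝ (⊤ : ℕ∞) (pd i v) := by
  have : ContDiff ℝ (⊤ : ℕ∞) (fderiv ℝ v) := hv.fderiv_right (by simp)
  exact this.clm_apply contDiff_const

theorem smooth_diff {n : ℕ} {v : (Fin n → ℝ) → ℝ} (hv : ContDiff ℝ (⊤ : ℕ∞) v) :
    Differentiable ℝ v := hv.differentiable (by simp)

theorem pd_mul {n : ℕ} {v w : (Fin n → ℝ) → ℝ} (hv : ContDiff ℝ (⊤ : ℕ∞) v)
    (hw : ContDiff ℝ (⊤ : ℕ∞) w) (i : Fin n) (x : Fin n → ℝ) :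
    pd i (fun y => v y * w y) x = v x * pd i w x + pd i v x * w x := by
  unfold pd
  rw [fderiv_fun_mul (smooth_diff hv x) (smooth_diff hw x)]
  simp [mul_comm]

theorem pd_sub {n : ℕ} {v w : (Fin n → ℝ) → ℝ} (hv : ContDiff ℝ (⊤ : ℕ∞) v)
    (hw : ContDiff ℝ (⊤ : ℕ∞) w) (i : Fin n) (x : Fin n → ℝ) :
    pd i (fun y => v y - w y) x = pd i v x - pd i w x := by
  unfold pd
  rw [fderiv_fun_sub (smooth_diff hv x) (smooth_diff hw x)]
  simp

theorem pd_comm {n : ℕ} {v : (Fin n → ℝ) → ℝ} (hv : ContDiff ℝ (⊤ : ℕ∞) v)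
    (i j : Fin n) (x : Fin n → ℝ) : pd i (pd j v) x = pd j (pd i v) x := by
  have h1 : ContDiff ℝ (⊤ : ℕ∞) (fderiv ℝ v) := hv.fderiv_right (by simp)
  have hd : DifferentiableAt ℝ (fderiv ℝ v) x := h1.differentiable (by simp) x
  have key : ∀ a b : Fin n, pd a (pd b v) x
      = fderiv ℝ (fderiv ℝ v) x (Pi.single a 1) (Pi.single b 1) := by
    intro a b
    unfold pd
    rw [fderiv_clm_apply hd (differentiableAt_const _)]
    simp
  rw [key, key]
  exact (hv.contDiffAt.isSymmSndFDerivAt (by simp only [minSmoothness_of_isRCLikeNormedField]; exact WithTop.coe_le_coe.2 (le_top : (2 : ℕ∞) ≤ ⊤))).eq _ _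

theorem pd_per {n : ℕ} {v : (Fin n → ℝ) → ℝ} (hv : ZPeriodic v) (i : Fin n) :
    ZPeriodic (pd i v) := by
  intro x z
  unfold pd
  rw [← fderiv_comp_add_right]
  congr 2
  funext y
  exact hv y z

theorem int_pd {n : ℕ} {v : (Fin n → ℝ) → ℝ} (hv : ContDiff ℝ (⊤ : ℕ∞) v) (hp : ZPeriodic v)
    (i : Fin n) : ∫ x in Set.Icc (0 : Fin n → ℝ) 1, pd i v x = 0 := by
  obtain _ | m := n
  · exact i.elim0
  have hc : Continuous (pd i v) := (pd_smooth hv i).continuous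
  have := integral_divergence_of_hasFDerivAt_off_countable' (0 : Fin (m + 1) → ℝ) 1
    (fun _ => zero_le_one) (fun j => if j = i then v else fun _ => 0)
    (fun j x => if j = i then fderiv ℝ v x else 0) ∅ Set.countable_empty
    (fun j => by
      split_ifs
      · exact hv.continuous.continuousOn
      · exact continuousOn_const)
    (fun x _ j => by
      by_cases h : j = i
      · simp only [h, if_true]
        exact (smooth_diff hv x).hasFDerivAt
      · simp only [h, if_false]
        exact hasFDerivAt_const _ _)
    (by
      have : (fun x => ∑ j, (if j = i then fderiv ℝ v x else 0) (Pi.single j 1)) = pd i v := by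
        funext x
        rw [Finset.sum_eq_single i]
        · simp [pd]
        · intro j _ h; simp [h]
        · simp
      rw [this]
      exact hc.continuousOn.integrableOn_compact isCompact_Icc)
  have h2 : (fun x => ∑ j, (if j = i then fderiv ℝ v x else 0) (Pi.single j 1)) = pd i v := by
    funext x
    rw [Finset.sum_eq_single i]
    · simp [pd]
    · intro j _ h; simp [h]
    · simp
  rw [h2] at this
  rw [this]
  refine Finset.sum_eq_zero fun j _ => ?_
  by_cases h : j = i
  · subst h
    simp only [if_true]
    rw [sub_eq_zero]
    congr 1
    funext x
    have := hp (j.insertNth ((0 : Fin (m + 1) → ℝ) j) x) (Pi.single j 1)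
    rw [← this]
    congr 1
    funext k
    refine Fin.succAboveCases j ?_ (fun l => ?_) k
    · simp
    · simp
  · simp [h]

theorem per_mul {n : ℕ} {v w : (Fin n → ℝ) → ℝ} (hv : ZPeriodic v) (hw : ZPeriodic w) :
    ZPeriodic (fun y => v y * w y) := fun x z => by
  simp only [hv x z, hw x z]

theorem per_sub {n : ℕ} {v w : (Fin n → ℝ) → ℝ} (hv : ZPeriodic v) (hw : ZPeriodic w) :
    ZPeriodic (fun y => v y - w y) := fun x z => by
  simp only [hv x z, hw x z]

theorem cont_int {n : ℕ} {v : (Fin n → ℝ) → ℝ} (hv : Continuous v) :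
    IntegrableOn v (Set.Icc (0 : Fin n → ℝ) 1) :=
  hv.continuousOn.integrableOn_compact isCompact_Icc

/-- The null Lagrangian terms integrate to zero. -/
theorem int_null {n : ℕ} (lam : ℝ) (z : (Fin n → ℝ) → ℝ) (om : Fin n → (Fin n → ℝ) → ℝ)
    (hz : ContDiff ℝ (⊤ : ℕ∞) z) (hzp : ZPeriodic z)
    (ho : ∀ i, ContDiff ℝ (⊤ : ℕ∞) (om i)) (hop : ∀ i, ZPeriodic (om i)) :
    ∫ x in Set.Icc (0 : Fin n → ℝ) 1, (- 2 * lam * (∑ i, (z x * pd i (om i) x + pd i z x * om i x))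
        + ∑ i, ∑ j, (pd i (om i) x * pd j (om j) x - pd j (om i) x * pd i (om j) x)) = 0 := by
  have h1 : ∀ x, (- 2 * lam * (∑ i, (z x * pd i (om i) x + pd i z x * om i x))
        + ∑ i, ∑ j, (pd i (om i) x * pd j (om j) x - pd j (om i) x * pd i (om j) x))
      = (- 2 * lam * (∑ i, pd i (fun y => z y * om i y) x)
        + ∑ i, ∑ j, (pd i (fun y => om i y * pd j (om j) y) x
            - pd j (fun y => om i y * pd i (om j) y) x)) := by
    intro x
    congr 1
    · congr 1
      exact Finset.sum_congr rfl fun i _ => (pd_mul hz (ho i) i x).symm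
    · refine Finset.sum_congr rfl fun i _ => Finset.sum_congr rfl fun j _ => ?_
      rw [pd_mul (ho i) (pd_smooth (ho j) j), pd_mul (ho i) (pd_smooth (ho j) i),
        pd_comm (ho j) i j]
      ring
  simp only [h1]
  have s1 : ∀ i, ContDiff ℝ (⊤ : ℕ∞) (fun y => z y * om i y) := fun i => hz.mul (ho i)
  have s2 : ∀ i j k, ContDiff ℝ (⊤ : ℕ∞) (fun y => om i y * pd k (om j) y) :=
    fun i j k => (ho i).mul (pd_smooth (ho j) k)
  have c1 : ∀ i, Continuous (pd i (fun y => z y * om i y)) := fun i =>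
    (pd_smooth (s1 i) i).continuous
  have c2 : ∀ i j k l, Continuous (pd l (fun y => om i y * pd k (om j) y)) := fun i j k l =>
    (pd_smooth (s2 i j k) l).continuous
  rw [integral_add (cont_int (by fun_prop)) (cont_int (by fun_prop)), integral_const_mul,
    integral_finsetSum _ fun i _ => cont_int (c1 i),
    integral_finsetSum _ fun i _ => cont_int (by fun_prop)]
  have e1 : ∑ i, ∫ x in Set.Icc (0 : Fin n → ℝ) 1, pd i (fun y => z y * om i y) x = 0 :=
    Finset.sum_eq_zero fun i _ => int_pd (s1 i) (per_mul hzp (hop i)) i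
  rw [e1, mul_zero, zero_add]
  refine Finset.sum_eq_zero fun i _ => ?_
  rw [integral_finsetSum _ fun j _ => cont_int (by fun_prop)]
  refine Finset.sum_eq_zero fun j _ => ?_
  rw [integral_sub (cont_int (c2 _ _ _ _)) (cont_int (c2 _ _ _ _)),
    int_pd (s2 _ _ _) (per_mul (hop i) (pd_per (hop j) j)),
    int_pd (s2 _ _ _) (per_mul (hop i) (pd_per (hop j) i)), sub_zero]

theorem cont_fip {X : Type} [TopologicalSpace X] {n : ℕ} {A M : X → Matrix (Fin n) (Fin n) ℝ}
    (hA : Continuous A) (hM : Continuous M) : Continuous fun x => fip (A x) (M x) := by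
  unfold fip
  exact (hA.matrix_transpose.matrix_mul hM).matrix_trace

theorem cont_op {n : ℕ} {𝒜 ℬ : Type} [TopologicalSpace 𝒜] [TopologicalSpace ℬ]
    (lam : ℝ) (hlam : 0 < lam)
    (A : (Fin n → ℝ) × 𝒜 × ℬ → Matrix (Fin n) (Fin n) ℝ)
    (b : (Fin n → ℝ) × 𝒜 × ℬ → Fin n → ℝ)
    (c f : (Fin n → ℝ) × 𝒜 × ℬ → ℝ) (hA : Continuous A) (hb : Continuous b) (hc : Continuous c)
    (hf : Continuous f) (hc0 : ∀ q, 0 < c q) (M : (Fin n → ℝ) → Matrix (Fin n) (Fin n) ℝ)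
    (p : Fin n → (Fin n → ℝ) → ℝ) (r : (Fin n → ℝ) → ℝ) (hM : Continuous M)
    (hp : ∀ i, Continuous (p i)) (hr : Continuous r) :
    Continuous fun q : (Fin n → ℝ) × 𝒜 × ℬ => gam lam (A q) (b q) (c q) *
      (-(fip (A q) (M q.1)) - (∑ i, b q i * p i q.1) + c q * r q.1 - f q) := by
  have h1 : Continuous fun q => fip (A q) (A q) := cont_fip hA hA
  have h2 : Continuous fun q : (Fin n → ℝ) × 𝒜 × ℬ => fip (A q) (M q.1) :=
    cont_fip hA (hM.comp continuous_fst)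
  have h3 : Continuous fun q => (A q).trace := hA.matrix_trace
  have hg : Continuous fun q => gam lam (A q) (b q) (c q) := by
    unfold gam
    refine Continuous.div (by fun_prop) (by fun_prop) fun q => ?_
    have hb0 : 0 ≤ ∑ i, b q i ^ 2 := Finset.sum_nonneg fun i _ => sq_nonneg _
    have := fip_self_nonneg (A q)
    have := hc0 q
    positivity
  fun_prop

theorem int_final {n : ℕ} (f₁ f₂ f₃ g₁ g₂ g₃ N : (Fin n → ℝ) → ℝ) (k₂ k₃ C D : ℝ)
    (h₁ : Continuous f₁) (h₂ : Continuous f₂) (h₃ : Continuous f₃) (h₄ : Continuous g₁)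
    (h₅ : Continuous g₂) (h₆ : Continuous g₃) (h₇ : Continuous N)
    (hN : ∫ x in Set.Icc (0 : Fin n → ℝ) 1, N x = 0)
    (h : ∀ x, f₁ x + k₂ * f₂ x + k₃ * f₃ x ≤ C * (g₁ x + g₂ x + g₃ x) - D * N x) :
    (∫ x in Set.Icc (0 : Fin n → ℝ) 1, f₁ x) + k₂ * (∫ x in Set.Icc (0 : Fin n → ℝ) 1, f₂ x)
      + k₃ * (∫ x in Set.Icc (0 : Fin n → ℝ) 1, f₃ x)
    ≤ C * ((∫ x in Set.Icc (0 : Fin n → ℝ) 1, g₁ x) + (∫ x in Set.Icc (0 : Fin n → ℝ) 1, g₂ x)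
      + ∫ x in Set.Icc (0 : Fin n → ℝ) 1, g₃ x) := by
  have hmono : ∫ x in Set.Icc (0 : Fin n → ℝ) 1, (f₁ x + k₂ * f₂ x + k₃ * f₃ x)
      ≤ ∫ x in Set.Icc (0 : Fin n → ℝ) 1, (C * (g₁ x + g₂ x + g₃ x) - D * N x) :=
    setIntegral_mono (cont_int (by fun_prop)) (cont_int (by fun_prop)) h
  rw [integral_add (cont_int (by fun_prop)) (cont_int (by fun_prop)),
    integral_add (cont_int (by fun_prop)) (cont_int (by fun_prop)),
    integral_const_mul, integral_const_mul,
    integral_sub (cont_int (by fun_prop)) (cont_int (by fun_prop)),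
    integral_const_mul, integral_const_mul, hN, mul_zero, sub_zero,
    integral_add (cont_int (by fun_prop)) (cont_int (by fun_prop)),
    integral_add (cont_int (by fun_prop)) (cont_int (by fun_prop))] at hmono
  exact hmono

/-- mixed a posteriori error bound for the periodic HJBI problem. -/
theorem stmt16 {n : ℕ} (hn : 2 ≤ n) (lam δ : ℝ) (hlam : 0 < lam)
    (hδ : δ ∈ Set.Ioo (0 : ℝ) 1) :
    ∃ C : ℝ, 0 < C ∧
      ∀ (𝒜 ℬ : Type) [MetricSpace 𝒜] [CompactSpace 𝒜] [Nonempty 𝒜]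
        [MetricSpace ℬ] [CompactSpace ℬ] [Nonempty ℬ]
        (A : (Fin n → ℝ) × 𝒜 × ℬ → Matrix (Fin n) (Fin n) ℝ)
        (b : (Fin n → ℝ) × 𝒜 × ℬ → Fin n → ℝ)
        (c f : (Fin n → ℝ) × 𝒜 × ℬ → ℝ),
        Continuous A → Continuous b → Continuous c → Continuous f →
        (∀ q, (A q).IsSymm) →
        (∀ (y : Fin n → ℝ) (z : Fin n → ℤ) (α : 𝒜) (β : ℬ),
          A ((y + fun i => (z i : ℝ)), α, β) = A (y, α, β)) →
        (∀ (y : Fin n → ℝ) (z : Fin n → ℤ) (α : 𝒜) (β : ℬ),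
          b ((y + fun i => (z i : ℝ)), α, β) = b (y, α, β)) →
        (∀ (y : Fin n → ℝ) (z : Fin n → ℤ) (α : 𝒜) (β : ℬ),
          c ((y + fun i => (z i : ℝ)), α, β) = c (y, α, β)) →
        (∀ (y : Fin n → ℝ) (z : Fin n → ℤ) (α : 𝒜) (β : ℬ),
          f ((y + fun i => (z i : ℝ)), α, β) = f (y, α, β)) →
        (∀ q, 0 < c q) →
        (∀ q, fip (A q) (A q) + (∑ i, b q i ^ 2) / (2 * lam) + c q ^ 2 / lam ^ 2
          ≤ (1 / ((n : ℝ) + δ)) * ((A q).trace + c q / lam) ^ 2) →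
        ∀ (u : (Fin n → ℝ) → ℝ), ContDiff ℝ (⊤ : ℕ∞) u → ZPeriodic u →
          (∀ y : Fin n → ℝ, Fgam lam A b c f u y = 0) →
        ∀ (w : (Fin n → ℝ) → Fin n → ℝ) (u' : (Fin n → ℝ) → ℝ),
          ContDiff ℝ (⊤ : ℕ∞) w → ContDiff ℝ (⊤ : ℕ∞) u' →
          ZPeriodicV w → ZPeriodic u' →
          (∫ x in Set.Icc (0 : Fin n → ℝ) 1, w x) = 0 →
          (∫ x in Set.Icc (0 : Fin n → ℝ) 1,
              fip (jac (fun y => (fun i => pd i u y) - w y) x)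
                  (jac (fun y => (fun i => pd i u y) - w y) x))
            + 2 * lam * (∫ x in Set.Icc (0 : Fin n → ℝ) 1, ∑ i, (pd i (u - u') x) ^ 2)
            + lam ^ 2 * (∫ x in Set.Icc (0 : Fin n → ℝ) 1, (u x - u' x) ^ 2)
          ≤ C * ((∫ x in Set.Icc (0 : Fin n → ℝ) 1, (FgamM lam A b c f w u' x) ^ 2)
              + (∫ x in Set.Icc (0 : Fin n → ℝ) 1,
                  fip (jac w x - (jac w x)ᵀ) (jac w x - (jac w x)ᵀ))
              + ∫ x in Set.Icc (0 : Fin n → ℝ) 1, ∑ i, (pd i u' x - w x i) ^ 2) := by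
  obtain ⟨hδ0, hδ1⟩ := hδ
  refine ⟨8 / (3 * δ) * (2 + 2 / δ + 4 * lam / δ), by positivity, ?_⟩
  intro 𝒜 ℬ _ _ _ _ _ _ A b c f hA hb hc hf hsym _ _ _ _ hc0 hcor u hu hup hF w u' hw hu' hwp hup' _
  have hwi : ∀ i, ContDiff ℝ (⊤ : ℕ∞) (fun y => w y i) := fun i => contDiff_pi.1 hw i
  set z : (Fin n → ℝ) → ℝ := fun y => u y - u' y with hzdef
  set om : Fin n → (Fin n → ℝ) → ℝ := fun i y => pd i u y - w y i with homdef
  have hz : ContDiff ℝ (⊤ : ℕ∞) z := hu.sub hu'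
  have hzp : ZPeriodic z := per_sub hup hup'
  have ho : ∀ i, ContDiff ℝ (⊤ : ℕ∞) (om i) := fun i => (pd_smooth hu i).sub (hwi i)
  have hop : ∀ i, ZPeriodic (om i) := fun i => per_sub (pd_per hup i)
    (fun x k => congrFun (hwp x k) i)
  have huu : u - u' = z := rfl
  set G : (Fin n → ℝ) → Matrix (Fin n) (Fin n) ℝ :=
    fun x => Matrix.of fun i j => pd j (om i) x with hGdef
  have hGj : ∀ x, jac (fun y => (fun i => pd i u y) - w y) x = G x := fun x => rfl
  have hGd : ∀ x, G x = hess u x - jac w x := by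
    intro x
    ext i j
    change pd j (om i) x = pd i (pd j u) x - pd j (fun y => w y i) x
    rw [pd_comm hu i j]
    exact pd_sub (pd_smooth hu i) (hwi i) j x
  have hrot : ∀ x, fip (jac w x - (jac w x)ᵀ) (jac w x - (jac w x)ᵀ)
      = fip (G x - (G x)ᵀ) (G x - (G x)ᵀ) := by
    intro x
    have hs : (hess u x)ᵀ = hess u x := by
      ext i j
      exact pd_comm hu j i x
    have : G x - (G x)ᵀ = -(jac w x - (jac w x)ᵀ) := by
      rw [hGd, Matrix.transpose_sub, hs]
      abel
    rw [this, fip, fip, Matrix.transpose_neg, neg_mul_neg]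
  have cG : Continuous G := continuous_matrix fun i j => (pd_smooth (ho i) j).continuous
  have cJ : Continuous (jac w) := continuous_matrix fun i j => (pd_smooth (hwi i) j).continuous
  have cH : Continuous (hess u) :=
    continuous_matrix fun i j => (pd_smooth (pd_smooth hu j) i).continuous
  have opM := cont_op lam hlam A b c f hA hb hc hf hc0 (jac w) (fun i => pd i u') u' cJ
    (fun i => (pd_smooth hu' i).continuous) hu'.continuous
  have opU := cont_op lam hlam A b c f hA hb hc hf hc0 (hess u) (fun i => pd i u) u cH
    (fun i => (pd_smooth hu i).continuous) hu.continuous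
  have cF : Continuous (FgamM lam A b c f w u') := infsup_cont _ opM
  -- the pointwise estimate
  have hpt : ∀ x, (FgamM lam A b c f w u' x + (lam * z x - (G x).trace)) ^ 2
      ≤ (1 - δ) * (fip (G x) (G x) + 2 * lam * (∑ i, pd i z x ^ 2) + lam ^ 2 * z x ^ 2) := by
    intro x
    set E := fip (G x) (G x) + 2 * lam * (∑ i, pd i z x ^ 2) + lam ^ 2 * z x ^ 2 with hE
    have hE0 : 0 ≤ E := by
      have := fip_self_nonneg (G x)
      have hp0 : 0 ≤ ∑ i, pd i z x ^ 2 := Finset.sum_nonneg fun i _ => sq_nonneg _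
      positivity
    have hE1 : 0 ≤ (1 - δ) * E := mul_nonneg (by linarith) hE0
    have ck : ∀ q : 𝒜 × ℬ, |(gam lam (A (x, q)) (b (x, q)) (c (x, q)) *
          (-(fip (A (x, q)) (hess u x)) - (∑ i, b (x, q) i * pd i u x)
            + c (x, q) * u x - f (x, q)))
        - (gam lam (A (x, q)) (b (x, q)) (c (x, q)) *
          (-(fip (A (x, q)) (jac w x)) - (∑ i, b (x, q) i * pd i u' x)
            + c (x, q) * u' x - f (x, q))) - (lam * z x - (G x).trace)|
        ≤ Real.sqrt ((1 - δ) * E) := by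
      intro q
      apply Real.abs_le_sqrt
      have := cordes lam δ hlam hδ0 (A (x, q)) (b (x, q)) (c (x, q)) (hc0 _) (hcor _) (G x)
        (fun i => pd i z x) (z x)
      refine le_trans (le_of_eq ?_) this
      congr 1
      have hs : ∑ i, b (x, q) i * pd i z x
          = (∑ i, b (x, q) i * pd i u x) - ∑ i, b (x, q) i * pd i u' x := by
        rw [← Finset.sum_sub_distrib]
        refine Finset.sum_congr rfl fun i _ => ?_
        rw [hzdef, pd_sub hu hu']
        ring
      have hf' : fip (A (x, q)) (G x)
          = fip (A (x, q)) (hess u x) - fip (A (x, q)) (jac w x) := by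
        rw [hGd, fip_sub_right]
      rw [hs, hf']
      simp only [hzdef]
      ring
    have cU : Continuous fun q : 𝒜 × ℬ => gam lam (A (x, q)) (b (x, q)) (c (x, q)) *
          (-(fip (A (x, q)) (hess u x)) - (∑ i, b (x, q) i * pd i u x)
            + c (x, q) * u x - f (x, q)) :=
      opU.comp (f := fun q : 𝒜 × ℬ => (x, q)) (by fun_prop)
    have cM : Continuous fun q : 𝒜 × ℬ => gam lam (A (x, q)) (b (x, q)) (c (x, q)) *
          (-(fip (A (x, q)) (jac w x)) - (∑ i, b (x, q) i * pd i u' x)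
            + c (x, q) * u' x - f (x, q)) :=
      opM.comp (f := fun q : 𝒜 × ℬ => (x, q)) (by fun_prop)
    have i1 : Fgam lam A b c f u x ≤ FgamM lam A b c f w u' x
        + ((lam * z x - (G x).trace) + Real.sqrt ((1 - δ) * E)) :=
      infsup_le _ _ cU cM _ fun α β => by
        have := (abs_le.1 (ck (α, β))).2
        linarith
    have i2 : FgamM lam A b c f w u' x ≤ Fgam lam A b c f u x
        + (-(lam * z x - (G x).trace) + Real.sqrt ((1 - δ) * E)) :=
      infsup_le _ _ cM cU _ fun α β => by
        have := (abs_le.1 (ck (α, β))).1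
        linarith
    rw [hF x] at i1 i2
    rw [← Real.sq_sqrt hE1]
    exact sq_le_sq' (by linarith) (by linarith)
  have hfin := fun x => alg lam δ hlam hδ0 (FgamM lam A b c f w u' x) (z x) (fun i => pd i z x)
    (fun i => om i x) (fun i => pd i u' x - w x i) (G x)
    (fun i => by simp only [hzdef, homdef, pd_sub hu hu']; ring) (hpt x)
  have hnull := int_null lam z om hz hzp ho hop
  have cz := hz.continuous
  have cpz : ∀ i, Continuous (pd i z) := fun i => (pd_smooth hz i).continuous
  have cpu' : ∀ i, Continuous (pd i u') := fun i => (pd_smooth hu' i).continuous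
  have cw : ∀ i, Continuous (fun y => w y i) := fun i => (hwi i).continuous
  have co : ∀ i, Continuous (om i) := fun i => (ho i).continuous
  have cpo : ∀ i j, Continuous (pd j (om i)) := fun i j => (pd_smooth (ho i) j).continuous
  have c1 : Continuous fun x => fip (G x) (G x) := cont_fip cG cG
  have c2 : Continuous fun x => fip (G x - (G x)ᵀ) (G x - (G x)ᵀ) :=
    cont_fip (cG.sub cG.matrix_transpose) (cG.sub cG.matrix_transpose)
  have c3 : Continuous fun x => ∑ i, pd i z x ^ 2 := by fun_prop
  have c4 : Continuous fun x => z x ^ 2 := by fun_prop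
  have c5 : Continuous fun x => FgamM lam A b c f w u' x ^ 2 := by fun_prop
  have c6 : Continuous fun x => ∑ i, (pd i u' x - w x i) ^ 2 := by fun_prop
  have c7 : Continuous fun x => (- 2 * lam * (∑ i, (z x * pd i (om i) x + pd i z x * om i x))
        + ∑ i, ∑ j, (pd i (om i) x * pd j (om j) x - pd j (om i) x * pd i (om j) x)) := by fun_prop
  simp only [hGj, hrot, huu]
  exact int_final _ _ _ _ _ _ _ _ _ _ _ c1 c3 c4 c5 c2 c6 c7 hnull hfin
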